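/- Let k be an algebraically closed field of characteristic 0 and L = L₁ × L₂ a direct product of Lie algebras over k. For i = 1,2 let U_i and V_i be irreducible finite-dimensional L_i-modules, and regard U₁⊗U₂ and V₁⊗V₂ as L-modules (L₁ acting on the first tensor factor and L₂ on the second). Then Ext¹_L(U₁⊗U₂, V₁⊗V₂), identified with H¹(L, Hom_k(U₁⊗U₂, V₁⊗V₂)), is: zero if U₁ ≇ V₁ and U₂ ≇ V₂; isomorphic to Ext¹_{L₂}(U₂,V₂) if U₁ ≅ V₁ and U₂ ≇ V₂; isomorphic to Ext¹_{L₁}(U₁,V₁) if U₁ ≇ V₁ and U₂ ≅ V₂; and isomorphic to Ext¹_{L₁}(U₁,V₁) ⊕ Ext¹_{L₂}(U₂,V₂) if U₁ ≅ V₁ and U₂ ≅ V₂. -/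

import Mathlib

/-! Extensions between tensor products of irreducible modules over a direct product
of Lie algebras. -/

open scoped TensorProduct

section ProdLie

variable {k L₁ L₂ : Type*} [CommRing k] [LieRing L₁] [LieAlgebra k L₁]
  [LieRing L₂] [LieAlgebra k L₂]

/-- The direct product of two Lie rings, with componentwise bracket. -/
instance Prod.instLieRing : LieRing (L₁ × L₂) where
  bracket x y := (⁅x.1, y.1⁆, ⁅x.2, y.2⁆)
  add_lie x y z := by simp [Prod.ext_iff]
  lie_add x y z := by simp [Prod.ext_iff]
  lie_self x := by simp [Prod.ext_iff]
  leibniz_lie x y z := by simp [Prod.ext_iff]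

/-- The direct product of two Lie algebras. -/
instance Prod.instLieAlgebra : LieAlgebra k (L₁ × L₂) where
  lie_smul c x y := Prod.ext_iff.mpr ⟨lie_smul c x.1 y.1, lie_smul c x.2 y.2⟩

end ProdLie

section H1

variable (k L M : Type*) [CommRing k] [LieRing L] [LieAlgebra k L]
  [AddCommGroup M] [Module k M] [LieRingModule L M] [LieModule k L M]

/-- The inner derivations from `L` to `M`, as a submodule of all Lie derivations. -/
def innerLieDerivations : Submodule k (LieDerivation k L M) where
  carrier := {d | ∃ v : M, ∀ x : L, d x = ⁅x, v⁆}
  add_mem' := by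
    rintro d e ⟨v, hv⟩ ⟨w, hw⟩
    exact ⟨v + w, fun x => by simp [hv x, hw x]⟩
  zero_mem' := ⟨0, fun x => by simp⟩
  smul_mem' := by
    rintro c d ⟨v, hv⟩
    exact ⟨c • v, fun x => by simp [hv x]⟩

/-- The first Lie algebra cohomology `H¹(L,M) = Der(L,M)/IDer(L,M)`. -/
def lieH1 := LieDerivation k L M ⧸ innerLieDerivations k L M

noncomputable instance : AddCommGroup (lieH1 k L M) := Submodule.Quotient.addCommGroup _
noncomputable instance : Module k (lieH1 k L M) := Submodule.Quotient.module _

end H1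

section Ext

variable (k L M N : Type*) [CommRing k] [LieRing L] [LieAlgebra k L]
  [AddCommGroup M] [Module k M] [LieRingModule L M] [LieModule k L M]
  [AddCommGroup N] [Module k N] [LieRingModule L N] [LieModule k L N]

/-- `Ext¹_L(M,N)`, realized as `H¹(L, Hom_k(M,N))` where `Hom_k(M,N)` carries the
`L`-module structure `(x•f)(m) = x•f(m) − f(x•m)`. -/
def lieExt1 := lieH1 k L (M →ₗ[k] N)

noncomputable instance : AddCommGroup (lieExt1 k L M N) :=
  inferInstanceAs (AddCommGroup (lieH1 k L (M →ₗ[k] N)))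
noncomputable instance : Module k (lieExt1 k L M N) :=
  inferInstanceAs (Module k (lieH1 k L (M →ₗ[k] N)))

end Ext

variable (k L₁ L₂ U₁ U₂ V₁ V₂ : Type*) [Field k] [IsAlgClosed k] [CharZero k]
  [LieRing L₁] [LieAlgebra k L₁] [LieRing L₂] [LieAlgebra k L₂]
  [AddCommGroup U₁] [Module k U₁] [LieRingModule L₁ U₁] [LieModule k L₁ U₁]
  [AddCommGroup U₂] [Module k U₂] [LieRingModule L₂ U₂] [LieModule k L₂ U₂]
  [AddCommGroup V₁] [Module k V₁] [LieRingModule L₁ V₁] [LieModule k L₁ V₁]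
  [AddCommGroup V₂] [Module k V₂] [LieRingModule L₂ V₂] [LieModule k L₂ V₂]

/-- A module over `L₁` is a module over `L₁ × L₂`, the second factor acting trivially. -/
instance fstModule (M : Type*) [AddCommGroup M] [LieRingModule L₁ M] :
    LieRingModule (L₁ × L₂) M where
  bracket x m := ⁅x.1, m⁆
  add_lie x y m := add_lie x.1 y.1 m
  lie_add x m n := lie_add x.1 m n
  leibniz_lie x y m := leibniz_lie x.1 y.1 m

instance fstLieModule (M : Type*) [AddCommGroup M] [Module k M] [LieRingModule L₁ M]
    [LieModule k L₁ M] : LieModule k (L₁ × L₂) M where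
  smul_lie c x m := smul_lie c x.1 m
  lie_smul c x m := lie_smul c x.1 m

/-- A module over `L₂` is a module over `L₁ × L₂`, the first factor acting trivially. -/
instance sndModule (M : Type*) [AddCommGroup M] [LieRingModule L₂ M] :
    LieRingModule (L₁ × L₂) M where
  bracket x m := ⁅x.2, m⁆
  add_lie x y m := add_lie x.2 y.2 m
  lie_add x m n := lie_add x.2 m n
  leibniz_lie x y m := leibniz_lie x.2 y.2 m

instance sndLieModule (M : Type*) [AddCommGroup M] [Module k M] [LieRingModule L₂ M]
    [LieModule k L₂ M] : LieModule k (L₁ × L₂) M where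
  smul_lie c x m := smul_lie c x.2 m
  lie_smul c x m := lie_smul c x.2 m

section Schur

variable {K 𝔤 U V : Type*} [Field K] [IsAlgClosed K] [LieRing 𝔤] [LieAlgebra K 𝔤]
  [AddCommGroup U] [Module K U] [LieRingModule 𝔤 U] [LieModule K 𝔤 U]
  [AddCommGroup V] [Module K V] [LieRingModule 𝔤 V] [LieModule K 𝔤 V]
  [LieModule.IsIrreducible K 𝔤 U] [LieModule.IsIrreducible K 𝔤 V]

omit [IsAlgClosed K] [LieAlgebra K 𝔤] [LieModule K 𝔤 U] [LieModule K 𝔤 V] in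
/-- A nonzero homomorphism between irreducible Lie modules is bijective. -/
theorem LieModuleHom.bijective_of_ne_zero (f : U →ₗ⁅K, 𝔤⁆ V) (hf : f ≠ 0) :
    Function.Bijective f := by
  rw [Function.Bijective, ← LieModuleHom.ker_eq_bot, ← LieModuleHom.range_eq_top]
  refine ⟨(eq_bot_or_eq_top f.ker).resolve_right fun h => hf ?_,
    (eq_bot_or_eq_top f.range).resolve_left fun h => hf ?_⟩
  · ext u
    exact LieModuleHom.mem_ker.mp (h ▸ LieSubmodule.mem_top u)
  · ext u
    have : f u ∈ f.range := (f.mem_range _).mpr ⟨u, rfl⟩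
    simpa [h] using this

/-- Schur's lemma: the invariants of `Hom(U, V)` are spanned by one element, which vanishes
exactly when `U` and `V` are not isomorphic. -/
theorem LieModule.exists_generator_invariants_linearMap [FiniteDimensional K U] :
    ∃ f₀ : U →ₗ[K] V, (∀ x : 𝔤, ⁅x, f₀⁆ = 0) ∧
      (∀ f : U →ₗ[K] V, (∀ x : 𝔤, ⁅x, f⁆ = 0) → ∃ c : K, f = c • f₀) ∧
      (f₀ = 0 ↔ ¬ Nonempty (U ≃ₗ⁅K, 𝔤⁆ V)) := by
  have hom (f : U →ₗ[K] V) (hf : ∀ x : 𝔤, ⁅x, f⁆ = 0) :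
      ∃ g : U →ₗ⁅K, 𝔤⁆ V, ∀ u, g u = f u := by
    refine ⟨{ f with map_lie' := fun {x u} => ?_ }, fun _ => rfl⟩
    have := LinearMap.congr_fun (hf x) u
    rw [LieHom.lie_apply, LinearMap.zero_apply, sub_eq_zero] at this
    exact this.symm
  have : Nontrivial U := LieModule.nontrivial_of_isIrreducible K 𝔤 U
  by_cases h : Nonempty (U ≃ₗ⁅K, 𝔤⁆ V)
  · obtain ⟨φ⟩ := h
    have hφ (x : 𝔤) (u : U) : φ ⁅x, u⁆ = ⁅x, φ u⁆ := LieModuleHom.map_lie φ.toLieModuleHom x u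
    refine ⟨φ.toLinearEquiv, fun x => ?_, fun f hf => ?_, ?_⟩
    · ext u
      simp [LieHom.lie_apply, hφ]
    · obtain ⟨c, hc⟩ := Module.End.exists_eigenvalue (φ.toLinearEquiv.symm.toLinearMap ∘ₗ f)
      obtain ⟨u, hu⟩ := hc.exists_hasEigenvector
      have hu0 : f u = c • φ u := by
        have := congrArg φ.toLinearEquiv hu.apply_eq_smul
        simpa using this
      obtain ⟨g, hg⟩ := hom (f - c • φ.toLinearEquiv.toLinearMap) (fun x => by
        ext v
        have := LinearMap.congr_fun (hf x) v
        simp only [LieHom.lie_apply, LinearMap.zero_apply] at this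
        simp [LieHom.lie_apply, hφ, sub_eq_zero.mp this])
      have hg0 : g = 0 := by
        by_contra h0
        refine hu.2 ((g.bijective_of_ne_zero h0).1 ?_)
        rw [hg, map_zero]
        simp [hu0]
      refine ⟨c, ?_⟩
      ext v
      have := hg v
      rw [hg0] at this
      exact sub_eq_zero.mp this.symm
    · refine iff_of_false (fun h0 => ?_) (not_not.mpr ⟨φ⟩)
      obtain ⟨u, hu⟩ := exists_ne (0 : U)
      exact hu (φ.toLinearEquiv.map_eq_zero_iff.mp (LinearMap.congr_fun h0 u))
  · refine ⟨0, by simp, fun f hf => ⟨0, ?_⟩, by simpa using h⟩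
    obtain ⟨g, hg⟩ := hom f hf
    by_cases g0 : g = 0
    · ext u
      simp [← hg, g0]
    · exact (h ⟨{ g with
        invFun := (LinearEquiv.ofBijective g.toLinearMap (g.bijective_of_ne_zero g0)).symm
        left_inv := (LinearEquiv.ofBijective g.toLinearMap (g.bijective_of_ne_zero g0)).left_inv
        right_inv :=
          (LinearEquiv.ofBijective g.toLinearMap (g.bijective_of_ne_zero g0)).right_inv }⟩).elim

end Schur

section Kunneth

variable {K 𝔤 𝔥 A B M : Type*} [Field K] [AddCommGroup A] [Module K A]
  [AddCommGroup B] [Module K B] [AddCommGroup M] [Module K M]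

/-- Contraction of the second tensor factor of `M ≃ A ⊗ B` against a functional. -/
noncomputable def contractSnd (e : A ⊗[K] B ≃ₗ[K] M) (β : B →ₗ[K] K) : M →ₗ[K] A :=
  (TensorProduct.rid K A).toLinearMap ∘ₗ β.lTensor A ∘ₗ e.symm.toLinearMap

/-- Contraction of the first tensor factor of `M ≃ A ⊗ B` against a functional. -/
noncomputable def contractFst (e : A ⊗[K] B ≃ₗ[K] M) (α : A →ₗ[K] K) : M →ₗ[K] B :=
  (TensorProduct.lid K B).toLinearMap ∘ₗ α.rTensor B ∘ₗ e.symm.toLinearMap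

@[simp]
theorem contractSnd_tmul (e : A ⊗[K] B ≃ₗ[K] M) (β : B →ₗ[K] K) (a : A) (b : B) :
    contractSnd e β (e (a ⊗ₜ b)) = β b • a := by
  simp [contractSnd]

@[simp]
theorem contractFst_tmul (e : A ⊗[K] B ≃ₗ[K] M) (α : A →ₗ[K] K) (a : A) (b : B) :
    contractFst e α (e (a ⊗ₜ b)) = α a • b := by
  simp [contractFst]

theorem contractSnd_add (e : A ⊗[K] B ≃ₗ[K] M) (β γ : B →ₗ[K] K) (m : M) :
    contractSnd e (β + γ) m = contractSnd e β m + contractSnd e γ m := by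
  simp [contractSnd, LinearMap.lTensor_add]

theorem contractSnd_smul (e : A ⊗[K] B ≃ₗ[K] M) (c : K) (β : B →ₗ[K] K) (m : M) :
    contractSnd e (c • β) m = c • contractSnd e β m := by
  simp [contractSnd, LinearMap.lTensor_smul]

theorem induction_tensorEquiv (e : A ⊗[K] B ≃ₗ[K] M) {p : M → Prop} (m : M)
    (tmul : ∀ a b, p (e (a ⊗ₜ b))) (add : ∀ m n, p m → p n → p (m + n)) : p m := by
  obtain ⟨t, rfl⟩ := e.surjective m
  induction t with
  | zero => simpa using tmul 0 0
  | tmul a b => exact tmul a b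
  | add s t hs ht => rw [map_add]; exact add _ _ hs ht

theorem sum_contractSnd_coord {ι : Type*} [Fintype ι] (e : A ⊗[K] B ≃ₗ[K] M)
    (b : Module.Basis ι K B) (m : M) :
    ∑ j, e (contractSnd e (b.coord j) m ⊗ₜ b j) = m := by
  induction m using induction_tensorEquiv e with
  | tmul x y =>
    simp only [contractSnd_tmul, TensorProduct.smul_tmul, ← map_sum, ← TensorProduct.tmul_sum]
    congr
    exact b.sum_repr y
  | add m n hm hn =>
    simp only [map_add, TensorProduct.add_tmul, Finset.sum_add_distrib, hm, hn]

variable [LieRing 𝔤] [LieAlgebra K 𝔤] [LieRing 𝔥] [LieAlgebra K 𝔥]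
  [LieRingModule 𝔤 A] [LieModule K 𝔤 A] [LieRingModule 𝔥 B] [LieModule K 𝔥 B]
  [LieRingModule (𝔤 × 𝔥) M] [LieModule K (𝔤 × 𝔥) M]
  {e : A ⊗[K] B ≃ₗ[K] M}
  (he : ∀ (x : 𝔤 × 𝔥) (a : A) (b : B), ⁅x, e (a ⊗ₜ b)⁆ = e (⁅x.1, a⁆ ⊗ₜ b + a ⊗ₜ ⁅x.2, b⁆))

include he

omit [LieAlgebra K 𝔥] [LieModule K 𝔥 B] [LieModule K (𝔤 × 𝔥) M] in
theorem contractSnd_lie_fst (β : B →ₗ[K] K) (x : 𝔤) (m : M) :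
    contractSnd e β ⁅((x, 0) : 𝔤 × 𝔥), m⁆ = ⁅x, contractSnd e β m⁆ := by
  induction m using induction_tensorEquiv e with
  | tmul a b => simp [he]
  | add m n hm hn => simp [hm, hn]

omit [LieAlgebra K 𝔤] [LieModule K 𝔤 A] [LieModule K (𝔤 × 𝔥) M] in
theorem contractSnd_lie_snd (β : B →ₗ[K] K) (y : 𝔥) (m : M) :
    contractSnd e β ⁅((0, y) : 𝔤 × 𝔥), m⁆ =
      contractSnd e (β ∘ₗ (LieModule.toEnd K 𝔥 B y : B →ₗ[K] B)) m := by
  induction m using induction_tensorEquiv e with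
  | tmul a b => simp [he]
  | add m n hm hn => simp [hm, hn]

omit [LieAlgebra K 𝔤] [LieModule K 𝔤 A] [LieModule K (𝔤 × 𝔥) M] in
theorem contractFst_lie_snd (α : A →ₗ[K] K) (y : 𝔥) (m : M) :
    contractFst e α ⁅((0, y) : 𝔤 × 𝔥), m⁆ = ⁅y, contractFst e α m⁆ := by
  induction m using induction_tensorEquiv e with
  | tmul a b => simp [he]
  | add m n hm hn => simp [hm, hn]

omit he in
theorem LieDerivation.lie_fst_apply_snd (D : LieDerivation K (𝔤 × 𝔥) M) (x : 𝔤) (y : 𝔥) :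
    ⁅((x, 0) : 𝔤 × 𝔥), D (0, y)⁆ = ⁅((0, y) : 𝔤 × 𝔥), D (x, 0)⁆ := by
  have h : ⁅((x, 0) : 𝔤 × 𝔥), ((0, y) : 𝔤 × 𝔥)⁆ = 0 :=
    Prod.ext (lie_zero x) (zero_lie y)
  have := D.apply_lie_eq_sub (x, 0) (0, y)
  rw [h, map_zero] at this
  exact sub_eq_zero.mp this.symm

/-- The derivation `x ↦ contractSnd e β (D (x, 0))`. -/
noncomputable def LieDerivation.contractSnd (D : LieDerivation K (𝔤 × 𝔥) M) (β : B →ₗ[K] K) :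
    LieDerivation K 𝔤 A where
  toLinearMap := _root_.contractSnd e β ∘ₗ D.toLinearMap ∘ₗ LinearMap.inl K 𝔤 𝔥
  leibniz' x y := by
    have h : ((⁅x, y⁆, 0) : 𝔤 × 𝔥) = ⁅((x, 0) : 𝔤 × 𝔥), ((y, 0) : 𝔤 × 𝔥)⁆ :=
      Prod.ext rfl (lie_self (0 : 𝔥)).symm
    simp only [LinearMap.comp_apply, LinearMap.inl_apply,
      LieDerivation.coeFn_coe]
    rw [h, D.apply_lie_eq_sub, map_sub, contractSnd_lie_fst he, contractSnd_lie_fst he]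

/-- The derivation `y ↦ contractFst e α (D (0, y))`. -/
noncomputable def LieDerivation.contractFst (D : LieDerivation K (𝔤 × 𝔥) M) (α : A →ₗ[K] K) :
    LieDerivation K 𝔥 B where
  toLinearMap := _root_.contractFst e α ∘ₗ D.toLinearMap ∘ₗ LinearMap.inr K 𝔤 𝔥
  leibniz' x y := by
    have h : ((0, ⁅x, y⁆) : 𝔤 × 𝔥) = ⁅((0, x) : 𝔤 × 𝔥), ((0, y) : 𝔤 × 𝔥)⁆ :=
      Prod.ext (lie_self (0 : 𝔤)).symm rfl
    simp only [LinearMap.comp_apply, LinearMap.inr_apply,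
      LieDerivation.coeFn_coe]
    rw [h, D.apply_lie_eq_sub, map_sub, contractFst_lie_snd he, contractFst_lie_snd he]

variable {a₀ : A} {b₀ : B} (ha₀ : ∀ x : 𝔤, ⁅x, a₀⁆ = 0) (hb₀ : ∀ y : 𝔥, ⁅y, b₀⁆ = 0)

/-- The derivation `(x, y) ↦ d x ⊗ b₀` for an invariant `b₀`. -/
noncomputable def LieDerivation.tmulRight :
    LieDerivation K 𝔤 A →ₗ[K] LieDerivation K (𝔤 × 𝔥) M where
  toFun d :=
    { toLinearMap := e.toLinearMap ∘ₗ (TensorProduct.mk K A B).flip b₀ ∘ₗ d.toLinearMap ∘ₗ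
        LinearMap.fst K 𝔤 𝔥
      leibniz' x y := by
        simp [he, hb₀] }
  map_add' d d' := by ext; simp
  map_smul' c d := by ext; simp [-TensorProduct.smul_tmul']

/-- The derivation `(x, y) ↦ a₀ ⊗ d y` for an invariant `a₀`. -/
noncomputable def LieDerivation.tmulLeft :
    LieDerivation K 𝔥 B →ₗ[K] LieDerivation K (𝔤 × 𝔥) M where
  toFun d :=
    { toLinearMap := e.toLinearMap ∘ₗ TensorProduct.mk K A B a₀ ∘ₗ d.toLinearMap ∘ₗ
        LinearMap.snd K 𝔤 𝔥
      leibniz' x y := by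
        simp [he, ha₀, TensorProduct.tmul_sub] }
  map_add' d d' := by ext; simp [TensorProduct.tmul_add]
  map_smul' c d := by ext; simp

@[simp]
theorem LieDerivation.tmulRight_apply (d : LieDerivation K 𝔤 A) (x : 𝔤 × 𝔥) :
    tmulRight he hb₀ d x = e (d x.1 ⊗ₜ b₀) := rfl

@[simp]
theorem LieDerivation.tmulLeft_apply (d : LieDerivation K 𝔥 B) (x : 𝔤 × 𝔥) :
    tmulLeft he ha₀ d x = e (a₀ ⊗ₜ d x.2) := rfl

/-- Modulo inner derivations, the restriction of a derivation to the first factor takes values in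
the tensor product with the invariants. -/
theorem LieDerivation.exists_apply_fst_eq [FiniteDimensional K B]
    (hB : ∀ b : B, (∀ y : 𝔥, ⁅y, b⁆ = 0) → ∃ c : K, b = c • b₀)
    (D : LieDerivation K (𝔤 × 𝔥) M) :
    ∃ (d : LieDerivation K 𝔤 A) (m : M), ∀ x : 𝔤,
      D (x, 0) = e (d x ⊗ₜ b₀) + ⁅((x, 0) : 𝔤 × 𝔥), m⁆ := by
  let S : Submodule K (Module.Dual K B) :=
    { carrier := {β | ∃ a : A, ∀ x : 𝔤, _root_.contractSnd e β (D (x, 0)) = ⁅x, a⁆}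
      add_mem' := by
        rintro β γ ⟨a, ha⟩ ⟨b, hb⟩
        exact ⟨a + b, fun x => by rw [contractSnd_add, ha, hb, lie_add]⟩
      zero_mem' := ⟨0, fun x => by simp [_root_.contractSnd]⟩
      smul_mem' := by
        rintro c β ⟨a, ha⟩
        exact ⟨c • a, fun x => by rw [contractSnd_smul, ha, lie_smul]⟩ }
  have hS (β : Module.Dual K B) (hβ : β b₀ = 0) : β ∈ S := by
    rw [← Subspace.dualCoannihilator_dualAnnihilator_eq (W := S), Submodule.mem_dualAnnihilator]
    intro b hb
    rw [Submodule.mem_dualCoannihilator] at hb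
    obtain ⟨c, rfl⟩ := hB b fun y => by
      rw [← Module.forall_dual_apply_eq_zero_iff K]
      refine fun γ => hb (γ ∘ₗ (LieModule.toEnd K 𝔥 B y : B →ₗ[K] B))
        ⟨_root_.contractSnd e γ (D (0, y)), fun x => ?_⟩
      rw [← contractSnd_lie_snd he, ← contractSnd_lie_fst he, lie_fst_apply_snd]
    simp [hβ]
  obtain ⟨d, hd⟩ : ∃ d : LieDerivation K 𝔤 A, ∀ β : Module.Dual K B, ∃ a : A, ∀ x : 𝔤,
      _root_.contractSnd e β (D (x, 0)) = β b₀ • d x + ⁅x, a⁆ := by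
    by_cases h0 : b₀ = 0
    · exact ⟨0, fun β => (hS β (by simp [h0])).imp fun a ha x => by simp [ha, h0]⟩
    · obtain ⟨β₀, hβ₀⟩ := Module.Projective.exists_dual_eq_one K h0
      refine ⟨D.contractSnd he β₀, fun β => ?_⟩
      obtain ⟨a, ha⟩ := hS (β + (-β b₀) • β₀) (by simp [hβ₀])
      refine ⟨a, fun x => ?_⟩
      rw [← ha, contractSnd_add, contractSnd_smul]
      simp [LieDerivation.contractSnd]
  let b := Module.finBasis K B
  choose a ha using fun j => hd (b.coord j)
  refine ⟨d, ∑ j, e (a j ⊗ₜ b j), fun x => ?_⟩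
  rw [← sum_contractSnd_coord e b (D (x, 0))]
  have hb : ∑ j, b.coord j b₀ • b j = b₀ := b.sum_repr b₀
  conv_rhs => rw [← hb]
  simp only [ha, TensorProduct.add_tmul, map_add, Finset.sum_add_distrib, lie_sum, he, map_sum,
    TensorProduct.tmul_sum, TensorProduct.smul_tmul, zero_lie, TensorProduct.tmul_zero, add_zero]

/-- A derivation vanishing on the first factor comes from the second factor. -/
theorem LieDerivation.exists_apply_snd_eq [FiniteDimensional K B]
    (hA : ∀ a : A, (∀ x : 𝔤, ⁅x, a⁆ = 0) → ∃ c : K, a = c • a₀)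
    (D : LieDerivation K (𝔤 × 𝔥) M) (hD : ∀ x : 𝔤, D (x, 0) = 0) :
    ∃ d : LieDerivation K 𝔥 B, ∀ y : 𝔥, D (0, y) = e (a₀ ⊗ₜ d y) := by
  have key (y : 𝔥) : ∃ b : B, D (0, y) = e (a₀ ⊗ₜ b) := by
    let b := Module.finBasis K B
    have (j : Fin (Module.finrank K B)) :
        ∃ c : K, _root_.contractSnd e (b.coord j) (D (0, y)) = c • a₀ := hA _ fun x => by
      rw [← contractSnd_lie_fst he, lie_fst_apply_snd, hD, lie_zero, map_zero]
    choose c hc using this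
    refine ⟨∑ j, c j • b j, ?_⟩
    rw [← sum_contractSnd_coord e b (D (0, y))]
    simp only [hc, TensorProduct.smul_tmul, TensorProduct.tmul_sum, map_sum]
  by_cases h0 : a₀ = 0
  · refine ⟨0, fun y => ?_⟩
    obtain ⟨b, hb⟩ := key y
    simp [hb, h0]
  · obtain ⟨α, hα⟩ := Module.Projective.exists_dual_eq_one K h0
    refine ⟨D.contractFst he α, fun y => ?_⟩
    obtain ⟨b, hb⟩ := key y
    simp [LieDerivation.contractFst, hb, hα]

/-- The map `(d, d') ↦ [d ⊗ b₀ + a₀ ⊗ d']` into `H¹(𝔤 × 𝔥, A ⊗ B)` given by invariants `a₀`,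
`b₀`. -/
noncomputable def lieH1ProdMap :
    LieDerivation K 𝔤 A × LieDerivation K 𝔥 B →ₗ[K] lieH1 K (𝔤 × 𝔥) M :=
  (innerLieDerivations K (𝔤 × 𝔥) M).mkQ ∘ₗ
    (LieDerivation.tmulRight he hb₀).coprod (LieDerivation.tmulLeft he ha₀)

theorem lieH1ProdMap_surjective [FiniteDimensional K B]
    (hA : ∀ a : A, (∀ x : 𝔤, ⁅x, a⁆ = 0) → ∃ c : K, a = c • a₀)
    (hB : ∀ b : B, (∀ y : 𝔥, ⁅y, b⁆ = 0) → ∃ c : K, b = c • b₀) :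
    Function.Surjective (lieH1ProdMap he ha₀ hb₀) := by
  intro t
  obtain ⟨D, rfl⟩ := Submodule.mkQ_surjective (innerLieDerivations K (𝔤 × 𝔥) M) t
  obtain ⟨d, m, hd⟩ := D.exists_apply_fst_eq he hB
  let I : LieDerivation K (𝔤 × 𝔥) M := LieDerivation.inner K (𝔤 × 𝔥) M m
  obtain ⟨d', hd'⟩ := (D - LieDerivation.tmulRight he hb₀ d - I).exists_apply_snd_eq he hA
    fun x => by simp [hd, I]
  refine ⟨(d, d'), (Submodule.Quotient.eq _).mpr ⟨-m, fun x => ?_⟩⟩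
  have hx : x = (x.1, 0) + (0, x.2) := by simp
  have hDx : D x = D (x.1, 0) + D (0, x.2) := by rw [← map_add, ← hx]
  have hm : ⁅x, m⁆ = ⁅((x.1, 0) : 𝔤 × 𝔥), m⁆ + ⁅((0, x.2) : 𝔤 × 𝔥), m⁆ := by
    rw [← add_lie, ← hx]
  have h2 := hd' x.2
  simp only [LieDerivation.sub_apply, LieDerivation.tmulRight_apply, map_zero,
    TensorProduct.zero_tmul, sub_zero, I, LieDerivation.inner_apply_apply, sub_eq_iff_eq_add] at h2
  simp only [LinearMap.coprod_apply, LieDerivation.sub_apply, LieDerivation.add_apply,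
    LieDerivation.tmulRight_apply, LieDerivation.tmulLeft_apply, hDx, hd, h2, lie_neg, hm]
  abel

theorem mem_ker_lieH1ProdMap {d : LieDerivation K 𝔤 A} {d' : LieDerivation K 𝔥 B} :
    (d, d') ∈ LinearMap.ker (lieH1ProdMap he ha₀ hb₀) ↔
      (b₀ ≠ 0 → d ∈ innerLieDerivations K 𝔤 A) ∧ (a₀ ≠ 0 → d' ∈ innerLieDerivations K 𝔥 B) := by
  have h : (d, d') ∈ LinearMap.ker (lieH1ProdMap he ha₀ hb₀) ↔
      ∃ m : M, ∀ x : 𝔤 × 𝔥, e (d x.1 ⊗ₜ b₀) + e (a₀ ⊗ₜ d' x.2) = ⁅x, m⁆ :=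
    Submodule.Quotient.mk_eq_zero _
  rw [h]
  constructor
  · rintro ⟨m, hm⟩
    refine ⟨fun h0 => ?_, fun h0 => ?_⟩
    · obtain ⟨β, hβ⟩ := Module.Projective.exists_dual_eq_one K h0
      refine ⟨contractSnd e β m, fun x => ?_⟩
      rw [← contractSnd_lie_fst he, ← hm]
      simp [hβ]
    · obtain ⟨α, hα⟩ := Module.Projective.exists_dual_eq_one K h0
      refine ⟨contractFst e α m, fun y => ?_⟩
      rw [← contractFst_lie_snd he, ← hm]
      simp [hα]
  · rintro ⟨h1, h2⟩
    have h1' : ∃ a : A, ∀ x, d x ⊗ₜ[K] b₀ = ⁅x, a⁆ ⊗ₜ b₀ := by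
      by_cases h0 : b₀ = 0
      · exact ⟨0, by simp [h0]⟩
      · exact (h1 h0).imp fun a ha x => by rw [ha]
    have h2' : ∃ b : B, ∀ y, a₀ ⊗ₜ[K] d' y = a₀ ⊗ₜ ⁅y, b⁆ := by
      by_cases h0 : a₀ = 0
      · exact ⟨0, by simp [h0]⟩
      · exact (h2 h0).imp fun a ha x => by rw [ha]
    obtain ⟨a, ha⟩ := h1'
    obtain ⟨b, hb⟩ := h2'
    exact ⟨e (a ⊗ₜ b₀) + e (a₀ ⊗ₜ b), fun x => by simp [he, ha, hb, ha₀, hb₀]⟩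

end Kunneth

/-- Two surjections with the same kernel have isomorphic targets. -/
theorem LinearMap.nonempty_linearEquiv_of_ker_eq {R X Y Z : Type*} [Ring R]
    [AddCommGroup X] [Module R X] [AddCommGroup Y] [Module R Y] [AddCommGroup Z] [Module R Z]
    {f : X →ₗ[R] Y} {g : X →ₗ[R] Z} (hf : Function.Surjective f) (hg : Function.Surjective g)
    (h : ∀ x, f x = 0 ↔ g x = 0) : Nonempty (Y ≃ₗ[R] Z) :=
  ⟨(f.quotKerEquivOfSurjective hf).symm ≪≫ₗ
    Submodule.quotEquivOfEq f.ker g.ker (Submodule.ext h) ≪≫ₗ g.quotKerEquivOfSurjective hg⟩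

theorem homTensorHomEquiv_lie {K 𝔤 𝔥 U₁ U₂ V₁ V₂ : Type*} [Field K]
    [LieRing 𝔤] [LieAlgebra K 𝔤] [LieRing 𝔥] [LieAlgebra K 𝔥]
    [AddCommGroup U₁] [Module K U₁] [LieRingModule 𝔤 U₁] [LieModule K 𝔤 U₁]
    [AddCommGroup U₂] [Module K U₂] [LieRingModule 𝔥 U₂] [LieModule K 𝔥 U₂]
    [AddCommGroup V₁] [Module K V₁] [LieRingModule 𝔤 V₁] [LieModule K 𝔤 V₁]
    [AddCommGroup V₂] [Module K V₂] [LieRingModule 𝔥 V₂] [LieModule K 𝔥 V₂]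
    [FiniteDimensional K U₁] [FiniteDimensional K U₂]
    [FiniteDimensional K V₁] [FiniteDimensional K V₂]
    (x : 𝔤 × 𝔥) (f : U₁ →ₗ[K] V₁) (g : U₂ →ₗ[K] V₂) :
    ⁅x, homTensorHomEquiv K U₁ U₂ V₁ V₂ (f ⊗ₜ g)⁆ =
      homTensorHomEquiv K U₁ U₂ V₁ V₂ (⁅x.1, f⁆ ⊗ₜ g + f ⊗ₜ ⁅x.2, g⁆) := by
  ext u v
  simp only [TensorProduct.AlgebraTensorModule.curry_apply, LinearMap.restrictScalars_self,
    TensorProduct.curry_apply, LieHom.lie_apply, homTensorHomEquiv_apply, map_add,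
    TensorProduct.homTensorHomMap_apply, TensorProduct.LieModule.lie_tmul_right, LinearMap.add_apply,
    TensorProduct.map_tmul, TensorProduct.sub_tmul, TensorProduct.tmul_sub]
  exact add_sub_add_comm _ _ _ _

/-- For irreducible finite-dimensional modules `U₁, V₁` over `L₁` and
`U₂, V₂` over `L₂`, the extensions of `U₁ ⊗ U₂` by `V₁ ⊗ V₂` over `L = L₁ × L₂`
(identified with `H¹(L, Hom_k(U₁⊗U₂, V₁⊗V₂))`) are: zero if `U₁ ≇ V₁`, `U₂ ≇ V₂`;
`Ext¹_{L₂}(U₂,V₂)` if `U₁ ≅ V₁`, `U₂ ≇ V₂`; `Ext¹_{L₁}(U₁,V₁)` if `U₁ ≇ V₁`, `U₂ ≅ V₂`;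
and `Ext¹_{L₁}(U₁,V₁) ⊕ Ext¹_{L₂}(U₂,V₂)` if `U₁ ≅ V₁`, `U₂ ≅ V₂`. -/
theorem lieExt1_prod_tensor
    [FiniteDimensional k U₁] [FiniteDimensional k U₂]
    [FiniteDimensional k V₁] [FiniteDimensional k V₂]
    [LieModule.IsIrreducible k L₁ U₁] [LieModule.IsIrreducible k L₂ U₂]
    [LieModule.IsIrreducible k L₁ V₁] [LieModule.IsIrreducible k L₂ V₂] :
    (¬ Nonempty (U₁ ≃ₗ⁅k,L₁⁆ V₁) → ¬ Nonempty (U₂ ≃ₗ⁅k,L₂⁆ V₂) →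
      ∀ x : lieExt1 k (L₁ × L₂) (U₁ ⊗[k] U₂) (V₁ ⊗[k] V₂), x = 0) ∧
    (Nonempty (U₁ ≃ₗ⁅k,L₁⁆ V₁) → ¬ Nonempty (U₂ ≃ₗ⁅k,L₂⁆ V₂) →
      Nonempty (lieExt1 k (L₁ × L₂) (U₁ ⊗[k] U₂) (V₁ ⊗[k] V₂) ≃ₗ[k]
        lieExt1 k L₂ U₂ V₂)) ∧
    (¬ Nonempty (U₁ ≃ₗ⁅k,L₁⁆ V₁) → Nonempty (U₂ ≃ₗ⁅k,L₂⁆ V₂) →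
      Nonempty (lieExt1 k (L₁ × L₂) (U₁ ⊗[k] U₂) (V₁ ⊗[k] V₂) ≃ₗ[k]
        lieExt1 k L₁ U₁ V₁)) ∧
    (Nonempty (U₁ ≃ₗ⁅k,L₁⁆ V₁) → Nonempty (U₂ ≃ₗ⁅k,L₂⁆ V₂) →
      Nonempty (lieExt1 k (L₁ × L₂) (U₁ ⊗[k] U₂) (V₁ ⊗[k] V₂) ≃ₗ[k]
        (lieExt1 k L₁ U₁ V₁ × lieExt1 k L₂ U₂ V₂))) := by
  obtain ⟨a₀, ha₀, hA, hA0⟩ :=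
    LieModule.exists_generator_invariants_linearMap (K := k) (𝔤 := L₁) (U := U₁) (V := V₁)
  obtain ⟨b₀, hb₀, hB, hB0⟩ :=
    LieModule.exists_generator_invariants_linearMap (K := k) (𝔤 := L₂) (U := U₂) (V := V₂)
  have he := homTensorHomEquiv_lie (K := k) (𝔤 := L₁) (𝔥 := L₂)
    (U₁ := U₁) (U₂ := U₂) (V₁ := V₁) (V₂ := V₂)
  have hF := lieH1ProdMap_surjective he ha₀ hb₀ hA hB
  have hker := fun d d' => mem_ker_lieH1ProdMap he ha₀ hb₀ (d := d) (d' := d')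
  rw [← not_iff_not, not_not, ← ne_eq] at hA0 hB0
  have m₁ := Submodule.mkQ_surjective (innerLieDerivations k L₁ (U₁ →ₗ[k] V₁))
  have m₂ := Submodule.mkQ_surjective (innerLieDerivations k L₂ (U₂ →ₗ[k] V₂))
  refine ⟨fun h₁ h₂ t => ?_, fun h₁ h₂ => ?_, fun h₁ h₂ => ?_, fun h₁ h₂ => ?_⟩ <;>
    rw [← hA0] at h₁ <;> rw [← hB0] at h₂
  · obtain ⟨⟨d, d'⟩, rfl⟩ := hF t
    exact (hker d d').mpr ⟨fun h => absurd h h₂, fun h => absurd h h₁⟩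
  · refine LinearMap.nonempty_linearEquiv_of_ker_eq hF
      (m₂.comp (LinearMap.snd_surjective (M := LieDerivation k L₁ (U₁ →ₗ[k] V₁))))
      (g := (innerLieDerivations k L₂ (U₂ →ₗ[k] V₂)).mkQ ∘ₗ LinearMap.snd k _ _) ?_
    rintro ⟨d, d'⟩
    refine (hker d d').trans (Iff.trans ?_ (Submodule.Quotient.mk_eq_zero _).symm)
    simp [h₁, h₂]
  · refine LinearMap.nonempty_linearEquiv_of_ker_eq hF
      (m₁.comp (LinearMap.fst_surjective (M₂ := LieDerivation k L₂ (U₂ →ₗ[k] V₂))))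
      (g := (innerLieDerivations k L₁ (U₁ →ₗ[k] V₁)).mkQ ∘ₗ LinearMap.fst k _ _) ?_
    rintro ⟨d, d'⟩
    refine (hker d d').trans (Iff.trans ?_ (Submodule.Quotient.mk_eq_zero _).symm)
    simp [h₁, h₂]
  · refine LinearMap.nonempty_linearEquiv_of_ker_eq hF (m₁.prodMap m₂)
      (g := (innerLieDerivations k L₁ (U₁ →ₗ[k] V₁)).mkQ.prodMap
        (innerLieDerivations k L₂ (U₂ →ₗ[k] V₂)).mkQ) ?_
    rintro ⟨d, d'⟩
    refine (hker d d').trans (Iff.trans ?_ (Prod.mk_eq_zero.trans (and_congr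
      (Submodule.Quotient.mk_eq_zero _) (Submodule.Quotient.mk_eq_zero _))).symm)
    simp [h₁, h₂]
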